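/- For any two groups A and B, the second group homology of their free product with trivial integer coefficients decomposes as a direct sum: H₂(A ∗ B; ℤ) ≅ H₂(A; ℤ) × H₂(B; ℤ). -/

import Mathlib

/-! Group homology in degree 2 with trivial `ℤ` coefficients, defined via the
(unnormalized) bar complex
`⋯ → ℤ[G³] → ℤ[G²] → ℤ[G] → ℤ → 0`. -/

/-- The bar differential `d₂ : ℤ[G²] → ℤ[G]` with trivial coefficients,
`(g, h) ↦ [h] - [g h] + [g]`. -/
noncomputable def barD2 (G : Type*) [Group G] : ((G × G) →₀ ℤ) →ₗ[ℤ] (G →₀ ℤ) :=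
  Finsupp.lift (G →₀ ℤ) ℤ (G × G) fun p =>
    Finsupp.single p.2 1 - Finsupp.single (p.1 * p.2) 1 + Finsupp.single p.1 1

/-- The bar differential `d₃ : ℤ[G³] → ℤ[G²]` with trivial coefficients,
`(g, h, k) ↦ [h, k] - [g h, k] + [g, h k] - [g, h]`. -/
noncomputable def barD3 (G : Type*) [Group G] :
    ((G × G × G) →₀ ℤ) →ₗ[ℤ] ((G × G) →₀ ℤ) :=
  Finsupp.lift ((G × G) →₀ ℤ) ℤ (G × G × G) fun t =>
    Finsupp.single (t.2.1, t.2.2) 1 - Finsupp.single (t.1 * t.2.1, t.2.2) 1 +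
      Finsupp.single (t.1, t.2.1 * t.2.2) 1 - Finsupp.single (t.1, t.2.1) 1

/-- The second group homology `H₂(G; ℤ)` of `G` with trivial integer
coefficients: the quotient of the 2-cycles of the bar complex by the
2-boundaries. -/
noncomputable def H2 (G : Type*) [Group G] : Type _ :=
  LinearMap.ker (barD2 G) ⧸
    (LinearMap.range (barD3 G)).comap (LinearMap.ker (barD2 G)).subtype

noncomputable instance (G : Type*) [Group G] : AddCommGroup (H2 G) :=
  inferInstanceAs (AddCommGroup
    (LinearMap.ker (barD2 G) ⧸
      (LinearMap.range (barD3 G)).comap (LinearMap.ker (barD2 G)).subtype))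

theorem barD2_single {G : Type*} [Group G] (g h : G) :
    barD2 G (Finsupp.single (g, h) 1) =
      Finsupp.single h 1 - Finsupp.single (g * h) 1 + Finsupp.single g 1 := by
  simp [barD2]

theorem barD3_single {G : Type*} [Group G] (g h k : G) :
    barD3 G (Finsupp.single (g, h, k) 1) =
      Finsupp.single (h, k) 1 - Finsupp.single (g * h, k) 1 +
        Finsupp.single (g, h * k) 1 - Finsupp.single (g, h) 1 := by
  simp [barD3]

/-- The map induced on bar 2-chains by a group homomorphism. -/
noncomputable def barMap2 {G H : Type*} [Group G] [Group H] (f : G →* H) :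
    ((G × G) →₀ ℤ) →ₗ[ℤ] ((H × H) →₀ ℤ) :=
  Finsupp.lmapDomain ℤ ℤ (Prod.map f f)

section Functoriality

variable {G H K : Type*} [Group G] [Group H] [Group K]

theorem barMap2_single (f : G →* H) (g h : G) (n : ℤ) :
    barMap2 f (Finsupp.single (g, h) n) = Finsupp.single (f g, f h) n := by
  simp [barMap2]

theorem barMap2_id : barMap2 (MonoidHom.id G) = LinearMap.id := by
  ext ⟨g, h⟩ : 2
  simp [barMap2_single]

theorem barMap2_comp (f : G →* H) (f' : H →* K) :
    barMap2 (f'.comp f) = barMap2 f' ∘ₗ barMap2 f := by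
  ext ⟨g, h⟩ : 2
  simp [barMap2_single]

theorem barD2_comp_barMap2 (f : G →* H) :
    barD2 H ∘ₗ barMap2 f = Finsupp.lmapDomain ℤ ℤ f ∘ₗ barD2 G := by
  ext ⟨g, h⟩ : 2
  simp only [LinearMap.comp_apply, Finsupp.lsingle_apply, barMap2_single, barD2_single, map_add,
    map_sub, Finsupp.lmapDomain_apply, Finsupp.mapDomain_single, map_mul]

theorem barD3_comp_map (f : G →* H) :
    barD3 H ∘ₗ Finsupp.lmapDomain ℤ ℤ (Prod.map f (Prod.map f f)) = barMap2 f ∘ₗ barD3 G := by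
  ext ⟨g, h, k⟩ : 2
  simp [barMap2_single, barD3_single, Finsupp.mapDomain_single]

theorem barMap2_mem_ker (f : G →* H) {z : (G × G) →₀ ℤ} (hz : z ∈ LinearMap.ker (barD2 G)) :
    barMap2 f z ∈ LinearMap.ker (barD2 H) := by
  have h := LinearMap.congr_fun (barD2_comp_barMap2 f) z
  simp only [LinearMap.comp_apply, LinearMap.mem_ker.mp hz, map_zero] at h
  exact h

theorem barMap2_mem_range (f : G →* H) {z : (G × G) →₀ ℤ} (hz : z ∈ LinearMap.range (barD3 G)) :
    barMap2 f z ∈ LinearMap.range (barD3 H) := by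
  obtain ⟨w, rfl⟩ := hz
  exact ⟨_, LinearMap.congr_fun (barD3_comp_map f) w⟩

/-- The trivial homomorphism induces zero on 2-cycles. -/
theorem barMap2_one_eq_zero {z : (G × G) →₀ ℤ} (hz : z ∈ LinearMap.ker (barD2 G)) :
    barMap2 (1 : G →* H) z = 0 := by
  have h : barMap2 (1 : G →* H) =
      Finsupp.lmapDomain ℤ ℤ (fun _ : G => ((1, 1) : H × H)) ∘ₗ barD2 G := by
    ext ⟨g, h⟩ : 2
    simp only [LinearMap.comp_apply, Finsupp.lsingle_apply, barMap2_single, barD2_single, map_add,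
      map_sub, Finsupp.lmapDomain_apply, Finsupp.mapDomain_single, MonoidHom.one_apply, sub_self,
      zero_add]
  rw [h, LinearMap.comp_apply, LinearMap.mem_ker.mp hz, map_zero]

end Functoriality

namespace H2

variable {G H K : Type*} [Group G] [Group H] [Group K]

/-- The homology class of a 2-cycle. -/
noncomputable def mk : LinearMap.ker (barD2 G) →+ H2 G :=
  (Submodule.mkQ ((LinearMap.range (barD3 G)).comap
    (LinearMap.ker (barD2 G)).subtype)).toAddMonoidHom

theorem mk_surjective : Function.Surjective (mk (G := G)) :=
  Submodule.mkQ_surjective _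

theorem mk_eq_mk_iff {z w : LinearMap.ker (barD2 G)} :
    mk z = mk w ↔ (z : (G × G) →₀ ℤ) - w ∈ LinearMap.range (barD3 G) :=
  Submodule.Quotient.eq _

/-- The map induced on `H₂` by a group homomorphism. -/
noncomputable def map (f : G →* H) : H2 G →+ H2 H :=
  (Submodule.mapQ
    ((LinearMap.range (barD3 G)).comap (LinearMap.ker (barD2 G)).subtype)
    ((LinearMap.range (barD3 H)).comap (LinearMap.ker (barD2 H)).subtype)
    ((barMap2 f).restrict fun _ hz => barMap2_mem_ker f hz)
    (fun _ hz => barMap2_mem_range f hz)).toAddMonoidHom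

theorem map_mk (f : G →* H) (z : LinearMap.ker (barD2 G)) :
    map f (mk z) = mk ⟨barMap2 f z, barMap2_mem_ker f z.2⟩ :=
  rfl

theorem map_id (x : H2 G) : map (MonoidHom.id G) x = x := by
  obtain ⟨z, rfl⟩ := mk_surjective x
  rw [map_mk]
  congr 1
  ext1
  simp [barMap2_id]

theorem map_map (f : G →* H) (f' : H →* K) (x : H2 G) :
    map f' (map f x) = map (f'.comp f) x := by
  obtain ⟨z, rfl⟩ := mk_surjective x
  simp only [map_mk]
  congr 1
  ext1
  simp [barMap2_comp]

theorem map_one (x : H2 G) : map (1 : G →* H) x = 0 := by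
  obtain ⟨z, rfl⟩ := mk_surjective x
  rw [map_mk, ← map_zero mk]
  congr 1
  ext1
  exact barMap2_one_eq_zero z.2

end H2

/-- The central extension of `G` by `M` attached to a 2-cocycle `c`, as a type. -/
@[ext]
structure CocycleExtension {G M : Type*} [Group G] [AddCommGroup M] (c : G → G → M) where
  /-- The coordinate in the kernel. -/
  fiber : M
  /-- The coordinate in the base group. -/
  base : G

namespace CocycleExtension

variable {G M : Type*} [Group G] [AddCommGroup M] {c : G → G → M}

instance : Mul (CocycleExtension c) :=
  ⟨fun x y => ⟨x.fiber + y.fiber + c x.base y.base, x.base * y.base⟩⟩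

instance : One (CocycleExtension c) := ⟨⟨-c 1 1, 1⟩⟩

instance : Inv (CocycleExtension c) :=
  ⟨fun x => ⟨-x.fiber - c x.base⁻¹ x.base - c 1 1, x.base⁻¹⟩⟩

theorem base_mul (x y : CocycleExtension c) : (x * y).base = x.base * y.base := rfl

theorem fiber_mul (x y : CocycleExtension c) :
    (x * y).fiber = x.fiber + y.fiber + c x.base y.base := rfl

/-- The group structure on the extension attached to a 2-cocycle. -/
abbrev group (hc : ∀ g h k, c h k - c (g * h) k + c g (h * k) - c g h = 0) :
    Group (CocycleExtension c) :=
  Group.ofLeftAxioms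
    (fun x y z => by
      ext1
      · simp only [fiber_mul, base_mul]
        rw [← sub_eq_zero, ← neg_eq_zero, ← hc x.base y.base z.base]
        abel
      · exact mul_assoc _ _ _)
    (fun x => by
      have h := hc 1 1 x.base
      simp only [one_mul, sub_self, zero_add] at h
      ext1
      · change -c 1 1 + x.fiber + c 1 x.base = x.fiber
        rw [sub_eq_zero.mp h]
        abel
      · exact one_mul _)
    (fun x => by
      ext1
      · change -x.fiber - c x.base⁻¹ x.base - c 1 1 + x.fiber + c x.base⁻¹ x.base = -c 1 1
        abel
      · exact inv_mul_cancel _)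

end CocycleExtension

section FreeProduct

open Monoid

variable {A B : Type*} [Group A] [Group B]

/-- A 2-cocycle on a free product which is a coboundary on both factors is a coboundary. -/
theorem exists_coboundary_coprod {M : Type*} [AddCommGroup M]
    (c : Coprod A B → Coprod A B → M)
    (hc : ∀ g h k, c h k - c (g * h) k + c g (h * k) - c g h = 0)
    (u : A → M) (hu : ∀ a a', c (Coprod.inl a) (Coprod.inl a') = u a' - u (a * a') + u a)
    (v : B → M) (hv : ∀ b b', c (Coprod.inr b) (Coprod.inr b') = v b' - v (b * b') + v b) :
    ∃ w : Coprod A B → M, ∀ g h, c g h = w h - w (g * h) + w g := by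
  let := CocycleExtension.group hc
  let p : CocycleExtension c →* Coprod A B :=
    MonoidHom.mk' CocycleExtension.base fun _ _ => rfl
  let sA : A →* CocycleExtension c := MonoidHom.mk' (fun a => ⟨-u a, Coprod.inl a⟩) fun a a' => by
    ext1
    · change -u (a * a') = -u a + -u a' + c (Coprod.inl a) (Coprod.inl a')
      rw [hu]
      abel
    · exact map_mul _ _ _
  let sB : B →* CocycleExtension c := MonoidHom.mk' (fun b => ⟨-v b, Coprod.inr b⟩) fun b b' => by
    ext1
    · change -v (b * b') = -v b + -v b' + c (Coprod.inr b) (Coprod.inr b')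
      rw [hv]
      abel
    · exact map_mul _ _ _
  let s := Coprod.lift sA sB
  have hs : p.comp s = MonoidHom.id _ := by
    apply Coprod.hom_ext
    · ext a
      simp [s, p, sA]
    · ext b
      simp [s, p, sB]
  have hbase (g) : (s g).base = g := DFunLike.congr_fun hs g
  refine ⟨fun g => -(s g).fiber, fun g h => ?_⟩
  have h_mul : (s (g * h)).fiber = (s g).fiber + (s h).fiber + c g h := by
    rw [map_mul, CocycleExtension.fiber_mul, hbase, hbase]
  dsimp only
  rw [h_mul]
  abel

/-- A character of 2-chains that vanishes on 2-cycles is a coboundary. -/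
theorem exists_coboundary_of_vanishing {G : Type*} [Group G]
    (χ : CharacterModule ((G × G) →₀ ℤ)) (hχ : ∀ z ∈ LinearMap.ker (barD2 G), χ z = 0) :
    ∃ u : G → AddCircle (1 : ℚ),
      ∀ g h, χ (Finsupp.single (g, h) 1) = u h - u (g * h) + u g := by
  let e := (barD2 G).quotKerEquivRange
  let χ₀ := (LinearMap.ker (barD2 G)).liftQ χ.toIntLinearMap fun z hz => hχ z hz
  let χ' : CharacterModule (LinearMap.range (barD2 G)) :=
    (χ₀ ∘ₗ e.symm.toLinearMap).toAddMonoidHom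
  obtain ⟨ψ, hψ⟩ := CharacterModule.dual_surjective_of_injective
    (LinearMap.range (barD2 G)).subtype (Submodule.subtype_injective _) χ'
  have key (z) : ψ (barD2 G z) = χ z := by
    have h := DFunLike.congr_fun hψ ⟨barD2 G z, z, rfl⟩
    refine h.trans ?_
    have : e.symm ⟨barD2 G z, z, rfl⟩ = Submodule.Quotient.mk z := by
      rw [LinearEquiv.symm_apply_eq]
      rfl
    change χ₀ (e.symm _) = χ z
    rw [this]
    rfl
  refine ⟨fun g => ψ (Finsupp.single g 1), fun g h => ?_⟩
  rw [← key, barD2_single, map_add, map_sub]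

/-- Every 2-cycle of a free product is homologous to a sum of 2-cycles of the factors. -/
theorem exists_cycles_coprod {z : (Coprod A B × Coprod A B) →₀ ℤ}
    (hz : z ∈ LinearMap.ker (barD2 (Coprod A B))) :
    ∃ x ∈ LinearMap.ker (barD2 A), ∃ y ∈ LinearMap.ker (barD2 B),
      barMap2 Coprod.inl x + barMap2 Coprod.inr y - z ∈ LinearMap.range (barD3 (Coprod A B)) := by
  let SA := (LinearMap.ker (barD2 A)).map (barMap2 (Coprod.inl : A →* Coprod A B))
  let SB := (LinearMap.ker (barD2 B)).map (barMap2 (Coprod.inr : B →* Coprod A B))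
  let R := LinearMap.range (barD3 (Coprod A B))
  suffices h : z ∈ SA ⊔ SB ⊔ R by
    obtain ⟨_, hxy, r, hr, rfl⟩ := Submodule.mem_sup.mp h
    obtain ⟨_, ⟨x, hx, rfl⟩, _, ⟨y, hy, rfl⟩, rfl⟩ := Submodule.mem_sup.mp hxy
    refine ⟨x, hx, y, hy, ?_⟩
    rw [sub_add_cancel_left]
    exact neg_mem hr
  by_contra hzS
  obtain ⟨χ', hχ'⟩ := CharacterModule.exists_character_apply_ne_zero_of_ne_zero
    (a := (SA ⊔ SB ⊔ R).mkQ z) (fun h => hzS ((Submodule.Quotient.mk_eq_zero _).mp h))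
  let χ : CharacterModule ((Coprod A B × Coprod A B) →₀ ℤ) :=
    AddMonoidHom.comp χ' (SA ⊔ SB ⊔ R).mkQ.toAddMonoidHom
  have hχ (w) (hw : w ∈ SA ⊔ SB ⊔ R) : χ w = 0 := by
    have : (SA ⊔ SB ⊔ R).mkQ w = 0 := (Submodule.Quotient.mk_eq_zero _).mpr hw
    change χ' ((SA ⊔ SB ⊔ R).mkQ w) = 0
    rw [this, map_zero]
  obtain ⟨u, hu⟩ := exists_coboundary_of_vanishing
    (AddMonoidHom.comp χ (barMap2 (Coprod.inl : A →* Coprod A B)).toAddMonoidHom)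
    fun x hx => hχ _ (le_sup_left (a := SA ⊔ SB) (le_sup_left (a := SA) ⟨x, hx, rfl⟩))
  obtain ⟨v, hv⟩ := exists_coboundary_of_vanishing
    (AddMonoidHom.comp χ (barMap2 (Coprod.inr : B →* Coprod A B)).toAddMonoidHom)
    fun y hy => hχ _ (le_sup_left (a := SA ⊔ SB) (le_sup_right (a := SA) ⟨y, hy, rfl⟩))
  obtain ⟨w, hw⟩ := exists_coboundary_coprod (fun g h => χ (Finsupp.single (g, h) 1))
    (fun g h k => by
      have := hχ _ (le_sup_right (a := SA ⊔ SB) ⟨Finsupp.single (g, h, k) 1, rfl⟩)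
      rw [barD3_single, map_sub, map_add, map_sub] at this
      exact this)
    u (fun a a' => by
      rw [← hu, ← barMap2_single]
      rfl)
    v (fun b b' => by
      rw [← hv, ← barMap2_single]
      rfl)
  have hfactor : χ.toIntLinearMap =
      Finsupp.lift (AddCircle (1 : ℚ)) ℤ (Coprod A B) w ∘ₗ barD2 (Coprod A B) := by
    ext ⟨g, h⟩ : 2
    simp only [LinearMap.comp_apply, Finsupp.lsingle_apply, barD2_single, map_add, map_sub]
    refine (hw g h).trans ?_
    simp
  apply hχ'
  change χ.toIntLinearMap z = 0
  rw [hfactor, LinearMap.comp_apply, LinearMap.mem_ker.mp hz, map_zero]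

end FreeProduct

open Monoid in
/-- `H₂(A ∗ B; ℤ) ≅ H₂(A; ℤ) × H₂(B; ℤ)` for any two groups `A`, `B`. -/
theorem H2_coprod (A B : Type*) [Group A] [Group B] :
    Nonempty (H2 (Coprod A B) ≃+ H2 A × H2 B) := by
  let i : H2 A × H2 B →+ H2 (Coprod A B) :=
    (H2.map Coprod.inl).coprod (H2.map Coprod.inr)
  let p : H2 (Coprod A B) →+ H2 A × H2 B :=
    (H2.map Coprod.fst).prod (H2.map Coprod.snd)
  have hpi (x) : p (i x) = x := by
    ext <;> simp [p, i, H2.map_map, H2.map_id, H2.map_one]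
  have hi : Function.Surjective i := fun q => by
    obtain ⟨⟨z, hz⟩, rfl⟩ := H2.mk_surjective q
    obtain ⟨x, hx, y, hy, h⟩ := exists_cycles_coprod hz
    refine ⟨(H2.mk ⟨x, hx⟩, H2.mk ⟨y, hy⟩), ?_⟩
    rw [AddMonoidHom.coprod_apply, H2.map_mk, H2.map_mk, ← map_add, H2.mk_eq_mk_iff]
    exact h
  exact ⟨(AddEquiv.ofBijective i ⟨Function.LeftInverse.injective hpi, hi⟩).symm⟩
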